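/- arXiv:1302.0914 — 5 statements merged into one kernel-verified Lean document; each statement's English description precedes it below -/
import Mathlib

section
/- For every M ∈ ℕ, all vectors u, v ∈ ℝ^M with nonnegative entries, and every subset J ⊆ [M] × [M], it holds that ∑_{(i,j) ∈ J} min(u_i, v_j) ≤ √(|J| · ‖u‖₁ · ‖v‖₁). -/
/-- For every `M ∈ ℕ`, all nonnegative vectors `u, v ∈ ℝ^M`, and every subset
`J ⊆ [M] × [M]`, we have `∑_{(i,j) ∈ J} min(u_i, v_j) ≤ √(|J| ⬝ ‖u‖₁ ⬝ ‖v‖₁)`. -/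
theorem stmt_0 (M : ℕ) (u v : Fin M → ℝ)
    (hu : ∀ i, 0 ≤ u i) (hv : ∀ i, 0 ≤ v i)
    (J : Finset (Fin M × Fin M)) :
    ∑ p ∈ J, min (u p.1) (v p.2) ≤
      Real.sqrt ((J.card : ℝ) * (∑ i, u i) * (∑ i, v i)) := by
  refine Real.le_sqrt_of_sq_le ?_
  calc (∑ p ∈ J, min (u p.1) (v p.2)) ^ 2
      ≤ (J.card : ℝ) * ∑ p ∈ J, min (u p.1) (v p.2) ^ 2 := sq_sum_le_card_mul_sum_sq
    _ ≤ (J.card : ℝ) * ∑ p : Fin M × Fin M, u p.1 * v p.2 := by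
        gcongr
        calc ∑ p ∈ J, min (u p.1) (v p.2) ^ 2
            ≤ ∑ p ∈ J, u p.1 * v p.2 := Finset.sum_le_sum fun p _ => by
              rw [sq]
              exact mul_le_mul (min_le_left _ _) (min_le_right _ _)
                (le_min (hu _) (hv _)) (hu _)
          _ ≤ ∑ p : Fin M × Fin M, u p.1 * v p.2 :=
              Finset.sum_le_univ_sum_of_nonneg fun p => mul_nonneg (hu _) (hv _)
    _ = (J.card : ℝ) * (∑ i, u i) * (∑ i, v i) := by
        rw [mul_assoc, Fintype.sum_mul_sum, Fintype.sum_prod_type]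
end

section
/- A hypergraph H = (V, E) is β-acyclic if and only if there exists an ordering v_1, …, v_n of all its vertices that is a nested elimination order, i.e., such that every prefix collection P_k of the order is a chain under set inclusion. -/
variable {α : Type*} [DecidableEq α]

/-- The hypergraph with edge collection `E` has a β-cycle: a sequence
`(F_1, u_1, F_2, u_2, …, F_k, u_k, F_{k+1} = F_1)` with `k ≥ 3`, distinct vertices `u_i`,
distinct hyperedges `F_i`, such that `u_i ∈ F_i ∩ F_{i+1}` and `u_i ∉ F_j` for all other `j`
(indices understood cyclically, so that `F_{k+1} = F_1`). -/
def HasBetaCycle (E : Finset (Finset α)) : Prop :=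
  ∃ (k : ℕ) (u : Fin (k + 3) → α) (F : Fin (k + 3) → Finset α),
    Function.Injective u ∧ Function.Injective F ∧ (∀ i, F i ∈ E) ∧
    (∀ i, u i ∈ F i ∧ u i ∈ F (i + 1)) ∧
    (∀ i j, j ≠ i → j ≠ i + 1 → u i ∉ F j)

/-- A hypergraph (given by its collection of hyperedges) is β-acyclic iff it has no β-cycle. -/
def BetaAcyclic (E : Finset (Finset α)) : Prop := ¬ HasBetaCycle E

/-- One elimination step: remove the vertex `x` from all hyperedges, and add the new
hyperedge `U(P) = ⋃ {F \ {x} : F ∈ E, x ∈ F}`. -/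
def elimStep (E : Finset (Finset α)) (x : α) : Finset (Finset α) :=
  E.image (fun F => F.erase x) ∪ {((E.filter (fun F => x ∈ F)).sup id).erase x}

/-- Eliminate the vertices of a list, starting from the last one:
`elimList E [v_{k+1}, …, v_n]` is the hypergraph `H_k` obtained from `E` by successively
eliminating `v_n, v_{n-1}, …, v_{k+1}`. -/
def elimList (E : Finset (Finset α)) : List α → Finset (Finset α)
  | [] => E
  | x :: xs => elimStep (elimList E xs) x

/-- The prefix collection `P` associated with eliminating vertex `x` from the hypergraph `E`:
`P = { F \ {x} : F ∈ E, x ∈ F }`. -/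
def Pcoll (E : Finset (Finset α)) (x : α) : Finset (Finset α) :=
  (E.filter (fun F => x ∈ F)).image (fun F => F.erase x)

theorem Fin.val_add_one_cyclic {k : ℕ} (i : Fin (k + 3)) :
    (i.val < k + 2 ∧ (i + 1).val = i.val + 1) ∨ (i.val = k + 2 ∧ (i + 1).val = 0) := by
  have := i.isLt
  rw [Fin.val_add_one]
  simp only [Fin.ext_iff, Fin.val_last]
  split_ifs <;> omega

/-- The hyperedges of a cyclic sequence as in a β-cycle are automatically distinct. -/
theorem injective_of_cyclic_incidence {V : Type*} {k : ℕ} {u : Fin (k + 3) → V}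
    {F : Fin (k + 3) → Finset V}
    (hu : ∀ i, u i ∈ F i ∧ u i ∈ F (i + 1))
    (hn : ∀ i j, j ≠ i → j ≠ i + 1 → u i ∉ F j) : Function.Injective F := by
  intro i j hij
  by_contra hne
  have hj : j = i + 1 := by
    by_contra h
    exact hn i j (Ne.symm hne) h (hij ▸ (hu i).1)
  have hi : i = j + 1 := by
    by_contra h
    exact hn j i hne h (hij ▸ (hu j).1)
  have := Fin.val_add_one_cyclic i
  have := Fin.val_add_one_cyclic j
  rw [Fin.ext_iff] at hi hj
  omega

/-- An alternating incidence pattern `c 0, r 1, c 2, …` and `c 1, r 2, c 3, …`, closed up at both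
ends by `c 0 ∈ r 0` and `c (k + 2) ∈ r (k + 2)`, is a β-cycle. -/
theorem hasBetaCycle_of_zigzag {V : Type*} {E : Finset (Finset V)} {k : ℕ}
    {r : ℕ → Finset V} {c : ℕ → V}
    (hE : ∀ i, r i ∈ E) (hc : ∀ i j, i ≤ k + 2 → j ≤ k + 2 → c i = c j → i = j)
    (h : ∀ i j, i ≤ k + 2 → j ≤ k + 2 →
      (c j ∈ r i ↔ i + 1 = j ∨ j + 1 = i ∨ (i = 0 ∧ j = 0) ∨ (i = k + 2 ∧ j = k + 2))) :
    HasBetaCycle E := by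
  set f : Fin (k + 3) → ℕ := fun i =>
    if 2 * i.val ≤ k + 2 then 2 * i.val else 2 * (k + 2 - i.val) + 1 with hf
  set g : Fin (k + 3) → ℕ := fun i =>
    if 2 * i.val + 1 ≤ k + 2 then 2 * i.val + 1 else 2 * (k + 2 - i.val) with hg
  have hf_le : ∀ i, f i ≤ k + 2 := by
    intro i; have := i.isLt; simp only [hf]; split_ifs <;> omega
  have hg_le : ∀ i, g i ≤ k + 2 := by
    intro i; have := i.isLt; simp only [hg]; split_ifs <;> omega
  have hinc : ∀ i, c (g i) ∈ r (f i) ∧ c (g i) ∈ r (f (i + 1)) := by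
    intro i
    rw [h _ _ (hf_le _) (hg_le _), h _ _ (hf_le _) (hg_le _)]
    have := Fin.val_add_one_cyclic i
    simp only [hf, hg]
    constructor <;> split_ifs <;> omega
  have hninc : ∀ i j, j ≠ i → j ≠ i + 1 → c (g i) ∉ r (f j) := by
    intro i j hji hji'
    rw [h _ _ (hf_le _) (hg_le _)]
    have := Fin.val_add_one_cyclic i
    have := j.isLt
    rw [ne_eq, Fin.ext_iff] at hji hji'
    dsimp only [f, g]
    split_ifs <;> grind
  refine ⟨k, fun i => c (g i), fun i => r (f i), ?_, injective_of_cyclic_incidence hinc hninc,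
    fun i => hE _, hinc, hninc⟩
  intro i j hij
  have := hc _ _ (hg_le i) (hg_le j) hij
  have := i.isLt
  have := j.isLt
  simp only [hg] at *
  apply Fin.ext
  split_ifs at * <;> omega

section DoublyLexical

variable {β γ : Type*}

/-- The rows of `M` are lexicographically increasing, where the order of the rows and columns is
given by `p` and `q` and rows are compared at the last column where they differ. -/
def RowLex {m n : ℕ} (M : β → γ → Prop) (p : β ≃ Fin m) (q : γ ≃ Fin n) : Prop :=
  ∀ b b' c, p b < p b' → M b c → ¬ M b' c →
    ∃ w, q c < q w ∧ M b' w ∧ ¬ M b w ∧ ∀ a, q w < q a → M b a → M b' a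

open Classical in
/-- The sum of `2 ^ (p b + q c)` over the entries `(b, c)` of `M`. -/
noncomputable def weight [Fintype β] [Fintype γ] {m n : ℕ} (M : β → γ → Prop) (p : β ≃ Fin m)
    (q : γ ≃ Fin n) : ℤ :=
  ∑ b, ∑ c, if M b c then 2 ^ (p b : ℕ) * 2 ^ (q c : ℕ) else 0

theorem weight_flip [Fintype β] [Fintype γ] {m n : ℕ} (M : β → γ → Prop) (p : β ≃ Fin m)
    (q : γ ≃ Fin n) : weight (flip M) q p = weight M p q := by
  unfold weight
  rw [Finset.sum_comm]
  refine Finset.sum_congr rfl fun b _ => Finset.sum_congr rfl fun c _ => ?_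
  rw [mul_comm]
  rfl

theorem rowLex_of_weight_max [Fintype β] [Fintype γ] {m n : ℕ} {M : β → γ → Prop} {p : β ≃ Fin m}
    {q : γ ≃ Fin n} (hmax : ∀ p' : β ≃ Fin m, weight M p' q ≤ weight M p q) : RowLex M p q := by
  classical
  intro b b' c hb hM hM'
  set s : β → Finset (Fin n) := fun b => (Finset.univ.filter (M b)).map q.toEmbedding with hs
  have mem_s : ∀ b c, q c ∈ s b ↔ M b c := by simp [hs]
  set R : β → ℕ := fun b => ∑ j ∈ (s b).map Fin.valEmbedding, 2 ^ j with hR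
  have weight_eq : ∀ p' : β ≃ Fin m, weight M p' q = ∑ b, 2 ^ (p' b : ℕ) * (R b : ℤ) := by
    intro p'
    unfold weight
    refine Finset.sum_congr rfl fun b _ => ?_
    simp [hR, hs, Finset.sum_filter, Finset.mul_sum]
  have hne : b ≠ b' := by rintro rfl; exact hM' hM
  have hRle : R b ≤ R b' := by
    have h := hmax ((Equiv.swap b b').trans p)
    rw [weight_eq, weight_eq, ← sub_nonpos, ← Finset.sum_sub_distrib,
      Finset.sum_eq_add b b' hne] at h
    · simp only [Equiv.trans_apply, Equiv.swap_apply_left, Equiv.swap_apply_right] at h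
      have hlt : (2 : ℤ) ^ (p b : ℕ) < 2 ^ (p b' : ℕ) :=
        pow_lt_pow_right₀ (by norm_num) hb
      have : (R b : ℤ) ≤ R b' := by nlinarith
      exact_mod_cast this
    · rintro x - ⟨hx, hx'⟩
      simp [Equiv.swap_apply_of_ne_of_ne hx hx']
    · simp
    · simp
  have hlt : toColex ((s b).map Fin.valEmbedding) < toColex ((s b').map Fin.valEmbedding) := by
    refine lt_of_le_of_ne ((Finset.geomSum_le_geomSum_iff_toColex_le_toColex le_rfl).1 hRle) ?_
    intro h
    have h' := Finset.map_injective _ (toColex_inj.1 h)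
    exact hM' ((mem_s _ _).1 (h' ▸ (mem_s _ _).2 hM))
  obtain ⟨w, hw, hw', hlast⟩ := Finset.Colex.toColex_lt_toColex_iff_exists_forall_lt.1 hlt
  obtain ⟨w, rfl⟩ : ∃ x, (q x : ℕ) = w := by
    obtain ⟨x, -, rfl⟩ := Finset.mem_map.1 hw
    exact ⟨q.symm x, by simp⟩
  have mem_s' : ∀ b c, (q c : ℕ) ∈ (s b).map Fin.valEmbedding ↔ M b c := by
    intro b c
    rw [← mem_s]
    exact Finset.mem_map' Fin.valEmbedding
  refine ⟨w, hlast _ ((mem_s' _ _).2 hM) (mt (mem_s' _ _).1 hM'), (mem_s' _ _).1 hw,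
    mt (mem_s' _ _).2 hw', fun a hwa ha => ?_⟩
  by_contra ha'
  exact lt_asymm hwa (hlast _ ((mem_s' _ _).2 ha) (mt (mem_s' _ _).1 ha'))

/-- Every finite 0-1 matrix has a doubly lexical ordering. -/
theorem exists_rowLex_and_rowLex_flip [Fintype β] [Fintype γ] (M : β → γ → Prop) :
    ∃ (p : β ≃ Fin (Fintype.card β)) (q : γ ≃ Fin (Fintype.card γ)),
      RowLex M p q ∧ RowLex (flip M) q p := by
  classical
  have : Nonempty ((β ≃ Fin (Fintype.card β)) × (γ ≃ Fin (Fintype.card γ))) :=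
    ⟨Fintype.equivFin β, Fintype.equivFin γ⟩
  obtain ⟨⟨p, q⟩, hmax⟩ := Finite.exists_max
    fun x : (β ≃ Fin (Fintype.card β)) × (γ ≃ Fin (Fintype.card γ)) => weight M x.1 x.2
  refine ⟨p, q, rowLex_of_weight_max fun p' => hmax (p', q), rowLex_of_weight_max fun q' => ?_⟩
  rw [weight_flip, weight_flip]
  exact hmax (p, q')

/-- An induced zigzag path with rows `r 0 < ⋯ < r (k + 1)` and columns `c 0 < ⋯ < c (k + 1)`. -/
structure IsZigzag {m n : ℕ} (M : β → γ → Prop) (p : β ≃ Fin m) (q : γ ≃ Fin n)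
    (k : ℕ) (r : ℕ → β) (c : ℕ → γ) : Prop where
  row_lt : ∀ i ≤ k, p (r i) < p (r (i + 1))
  col_lt : ∀ i ≤ k, q (c i) < q (c (i + 1))
  inc : ∀ i j, i ≤ k + 1 → j ≤ k + 1 →
    (M (r i) (c j) ↔ i + 1 = j ∨ j + 1 = i ∨ (i = 0 ∧ j = 0))
  row_dom : ∀ i ≤ k, ∀ a, q (c (k + 1)) < q a → M (r i) a → M (r k) a
  col_dom : ∀ i ≤ k, ∀ b, p (r (k + 1)) < p b → M b (c i) → M b (c k)

/-- In a doubly lexical ordering, an induced zigzag path extends by one row and one column; the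
only entry which is not determined is the one in the new corner. -/
theorem IsZigzag.extend {m n : ℕ} {M : β → γ → Prop} {p : β ≃ Fin m} {q : γ ≃ Fin n}
    (hrow : RowLex M p q) (hcol : RowLex (flip M) q p) {k : ℕ} {r : ℕ → β} {c : ℕ → γ}
    (h : IsZigzag M p q k r c) :
    ∃ r' c', (∀ i j, i ≤ k + 2 → j ≤ k + 2 → ¬ (i = k + 2 ∧ j = k + 2) →
        (M (r' i) (c' j) ↔ i + 1 = j ∨ j + 1 = i ∨ (i = 0 ∧ j = 0))) ∧
      (∀ i ≤ k + 1, q (c' i) < q (c' (i + 1))) ∧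
      (¬ M (r' (k + 2)) (c' (k + 2)) → IsZigzag M p q (k + 1) r' c') := by
  have hk : M (r k) (c (k + 1)) := (h.inc _ _ (by omega) (by omega)).2 (by omega)
  have hk' : M (r (k + 1)) (c k) := (h.inc _ _ (by omega) (by omega)).2 (by omega)
  have hkk : ¬ M (r (k + 1)) (c (k + 1)) := fun hh => by
    have := (h.inc _ _ (by omega) (by omega)).1 hh
    omega
  obtain ⟨w, hw, hMw, hMw', hwdom⟩ := hrow _ _ _ (h.row_lt k le_rfl) hk hkk
  obtain ⟨z, hz, hMz, hMz', hzdom⟩ := hcol _ _ _ (h.col_lt k le_rfl) hk' hkk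
  simp only [flip] at hMz hMz' hzdom
  set r' : ℕ → β := fun i => if i ≤ k + 1 then r i else z with hr'
  set c' : ℕ → γ := fun i => if i ≤ k + 1 then c i else w with hc'
  have r'_old : ∀ i ≤ k + 1, r' i = r i := fun i hi => if_pos hi
  have c'_old : ∀ i ≤ k + 1, c' i = c i := fun i hi => if_pos hi
  have r'_new : r' (k + 2) = z := if_neg (by omega)
  have c'_new : c' (k + 2) = w := if_neg (by omega)
  have hinc : ∀ i j, i ≤ k + 2 → j ≤ k + 2 → ¬ (i = k + 2 ∧ j = k + 2) →
      (M (r' i) (c' j) ↔ i + 1 = j ∨ j + 1 = i ∨ (i = 0 ∧ j = 0)) := by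
    intro i j hi hj hij
    rcases Nat.lt_or_ge (k + 1) i with hi' | hi'
    · obtain rfl : i = k + 2 := by omega
      have hj' : j ≤ k + 1 := by omega
      rw [r'_new, c'_old j hj']
      rcases Nat.lt_or_ge k j with hjk | hjk
      · obtain rfl : j = k + 1 := by omega
        simp [hMz]
      · have : ¬ M z (c j) := fun hh => hMz' (h.col_dom j hjk z hz hh)
        simp only [this, false_iff]
        omega
    rcases Nat.lt_or_ge (k + 1) j with hj' | hj'
    · obtain rfl : j = k + 2 := by omega
      rw [c'_new, r'_old i hi']
      rcases Nat.lt_or_ge k i with hik | hik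
      · obtain rfl : i = k + 1 := by omega
        simp [hMw]
      · have : ¬ M (r i) w := fun hh => hMw' (h.row_dom i hik w hw hh)
        simp only [this, false_iff]
        omega
    · rw [r'_old i hi', c'_old j hj']
      exact h.inc i j hi' hj'
  have hcol_lt : ∀ i ≤ k + 1, q (c' i) < q (c' (i + 1)) := by
    intro i hi
    rcases Nat.lt_or_ge k i with hik | hik
    · obtain rfl : i = k + 1 := by omega
      rw [c'_old _ le_rfl, c'_new]
      exact hw
    · rw [c'_old _ hi, c'_old _ (by omega)]
      exact h.col_lt i hik
  have hrow_lt : ∀ i ≤ k + 1, p (r' i) < p (r' (i + 1)) := by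
    intro i hi
    rcases Nat.lt_or_ge k i with hik | hik
    · obtain rfl : i = k + 1 := by omega
      rw [r'_old _ le_rfl, r'_new]
      exact hz
    · rw [r'_old _ hi, r'_old _ (by omega)]
      exact h.row_lt i hik
  refine ⟨r', c', hinc, hcol_lt, fun hcorner => ⟨hrow_lt, hcol_lt, ?_, ?_, ?_⟩⟩
  · intro i j hi hj
    by_cases hij : i = k + 2 ∧ j = k + 2
    · obtain ⟨rfl, rfl⟩ := hij
      simp only [hcorner, false_iff]
      omega
    · exact hinc i j hi hj hij
  · intro i hi a ha
    rw [c'_new] at ha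
    rw [r'_old i hi, r'_old _ le_rfl]
    rcases Nat.lt_or_ge k i with hik | hik
    · obtain rfl : i = k + 1 := by omega
      exact id
    · exact fun hM => hwdom a ha (h.row_dom i hik a (hw.trans ha) hM)
  · intro i hi b hb
    rw [r'_new] at hb
    rw [c'_old i hi, c'_old _ le_rfl]
    rcases Nat.lt_or_ge k i with hik | hik
    · obtain rfl : i = k + 1 := by omega
      exact id
    · exact fun hM => hzdom b hb (h.col_dom i hik b (hz.trans hb) hM)

end DoublyLexical

/-- A doubly lexical ordering of the incidence matrix of a β-acyclic hypergraph has no submatrix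
with rows `(1, 1)` and `(1, 0)`. -/
theorem BetaAcyclic.not_isZigzag {V : Type*} {E : Finset (Finset V)}
    (hE : BetaAcyclic E) {S : Finset V}
    {m n : ℕ} {p : E ≃ Fin m} {q : S ≃ Fin n}
    (hrow : RowLex (fun (F : E) (a : S) => a.1 ∈ F.1) p q)
    (hcol : RowLex (flip fun (F : E) (a : S) => a.1 ∈ F.1) q p) (r : ℕ → E) (c : ℕ → S) :
    ¬ IsZigzag (fun (F : E) (a : S) => a.1 ∈ F.1) p q 0 r c := by
  intro h0
  have hex : ∀ k, ∃ r c, IsZigzag (fun (F : E) (a : S) => a.1 ∈ F.1) p q k r c := by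
    intro k
    induction k with
    | zero => exact ⟨r, c, h0⟩
    | succ k ih =>
      obtain ⟨r, c, h⟩ := ih
      obtain ⟨r', c', hinc, hlt, hext⟩ := h.extend hrow hcol
      refine ⟨r', c', hext fun hcorner => hE ?_⟩
      have hmono : ∀ j ≤ k + 2, ∀ i < j, q (c' i) < q (c' j) := by
        intro j
        induction j with
        | zero => intro _ i hi; omega
        | succ j ihj =>
          intro hj i hi
          rcases Nat.lt_succ_iff_lt_or_eq.1 hi with hi | rfl
          · exact (ihj (by omega) i hi).trans (hlt j (by omega))
          · exact hlt i (by omega)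
      refine hasBetaCycle_of_zigzag (k := k) (r := fun i => (r' i).1) (c := fun i => (c' i).1)
        (fun i => (r' i).2) (fun i j hi hj hij => ?_) fun i j hi hj => ?_
      · have hij : q (c' i) = q (c' j) := congrArg q (Subtype.ext hij)
        rcases lt_trichotomy i j with hlt' | rfl | hlt'
        · exact absurd hij (hmono j hj i hlt').ne
        · rfl
        · exact absurd hij (hmono i hi j hlt').ne'
      · by_cases hij : i = k + 2 ∧ j = k + 2
        · obtain ⟨rfl, rfl⟩ := hij
          simpa using hcorner
        · rw [hinc i j hi hj hij]
          simp [hij]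
  obtain ⟨r, c, h⟩ := hex n
  have hle : ∀ i ≤ n + 1, i ≤ (q (c i) : ℕ) := by
    intro i
    induction i with
    | zero => simp
    | succ i ih =>
      intro hi
      have h1 := ih (by omega)
      have h2 : (q (c i) : ℕ) < q (c (i + 1)) := h.col_lt i (by omega)
      omega
  have := hle (n + 1) le_rfl
  have := (q (c (n + 1))).isLt
  omega

/-- Every β-acyclic hypergraph on a nonempty vertex set has a nest point. -/
theorem BetaAcyclic.exists_isChain_Pcoll {E : Finset (Finset α)} (hE : BetaAcyclic E)
    {S : Finset α} (hS : S.Nonempty) (hES : ∀ F ∈ E, F ⊆ S) :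
    ∃ x ∈ S, IsChain (· ⊆ ·) (Pcoll E x : Set (Finset α)) := by
  obtain ⟨p, q, hrow, hcol⟩ := exists_rowLex_and_rowLex_flip fun (F : E) (a : S) => a.1 ∈ F.1
  have : Nonempty S := hS.to_subtype
  obtain ⟨x, hx⟩ := Finite.exists_min q
  have hsub : ∀ F G : E, x.1 ∈ F.1 → x.1 ∈ G.1 → p F < p G → F.1 ⊆ G.1 := by
    intro F G hF hG hFG a haF
    by_contra haG
    set y : S := ⟨a, hES _ F.2 haF⟩ with hy
    have hxy : q x < q y := by
      refine lt_of_le_of_ne (hx y) fun h => haG ?_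
      have : x = y := q.injective h
      simpa [this, hy] using hG
    refine hE.not_isZigzag hrow hcol (fun i => if i = 0 then F else G)
      (fun i => if i = 0 then x else y) ⟨?_, ?_, ?_, ?_, ?_⟩
    · intro i hi
      obtain rfl : i = 0 := by omega
      simpa using hFG
    · intro i hi
      obtain rfl : i = 0 := by omega
      simpa using hxy
    · intro i j hi hj
      have hyF : y.1 ∈ F.1 := haF
      have hyG : y.1 ∉ G.1 := haG
      interval_cases i <;> interval_cases j <;> simp [hF, hG, hyF, hyG]
    · intro i hi
      obtain rfl : i = 0 := by omega
      exact fun _ _ => id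
    · intro i hi
      obtain rfl : i = 0 := by omega
      exact fun _ _ => id
  refine ⟨x, x.2, ?_⟩
  intro A hA B hB hAB
  simp only [Pcoll, Finset.coe_image, Set.mem_image, Finset.mem_coe, Finset.mem_filter] at hA hB
  obtain ⟨F, ⟨hFE, hF⟩, rfl⟩ := hA
  obtain ⟨G, ⟨hGE, hG⟩, rfl⟩ := hB
  rcases lt_trichotomy (p ⟨F, hFE⟩) (p ⟨G, hGE⟩) with h | h | h
  · exact Or.inl (Finset.erase_subset_erase _ (hsub ⟨F, hFE⟩ ⟨G, hGE⟩ hF hG h))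
  · exact absurd (congrArg (fun H : E => H.1.erase x.1) (p.injective h)) hAB
  · exact Or.inr (Finset.erase_subset_erase _ (hsub ⟨G, hGE⟩ ⟨F, hFE⟩ hG hF h))

/-- When the prefix collection of `x` is a chain, the hyperedge added by the elimination step is
either empty or the trace of a hyperedge. -/
theorem eq_erase_or_eq_empty_of_mem_elimStep {E : Finset (Finset α)} {x : α}
    (hx : IsChain (· ⊆ ·) (Pcoll E x : Set (Finset α))) {F : Finset α} (hF : F ∈ elimStep E x) :
    (∃ G ∈ E, G.erase x = F) ∨ F = ∅ := by
  rcases Finset.mem_union.1 hF with h | h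
  · exact Or.inl (Finset.mem_image.1 h)
  rw [Finset.mem_singleton] at h
  rcases (E.filter (x ∈ ·)).eq_empty_or_nonempty with hemp | hne
  · right
    simp [h, hemp]
  left
  obtain ⟨G, hG, hmax⟩ := Finset.exists_max_image _ (fun F : Finset α => (F.erase x).card) hne
  refine ⟨G, (Finset.mem_filter.1 hG).1, ?_⟩
  rw [h]
  refine (Finset.erase_subset_erase _ (Finset.le_sup (f := id) hG)).antisymm ?_
  intro a ha
  obtain ⟨hax, ha⟩ := Finset.mem_erase.1 ha
  obtain ⟨K, hK, haK⟩ := Finset.mem_sup.1 ha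
  have haK' : a ∈ K.erase x := Finset.mem_erase.2 ⟨hax, haK⟩
  rcases hx.total (x := K.erase x) (y := G.erase x)
    (Finset.mem_coe.2 (Finset.mem_image_of_mem _ hK))
    (Finset.mem_coe.2 (Finset.mem_image_of_mem _ hG)) with hKG | hGK
  · exact hKG haK'
  · rwa [id, Finset.eq_of_subset_of_card_le hGK (hmax K hK)]

theorem notMem_of_mem_elimStep {E : Finset (Finset α)} {x : α} {F : Finset α}
    (hF : F ∈ elimStep E x) : x ∉ F := by
  rcases Finset.mem_union.1 hF with h | h
  · obtain ⟨G, -, rfl⟩ := Finset.mem_image.1 h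
    exact Finset.notMem_erase _ _
  · rw [Finset.mem_singleton.1 h]
    exact Finset.notMem_erase _ _

theorem hasBetaCycle_elimStep_iff {E : Finset (Finset α)} {x : α}
    (hx : IsChain (· ⊆ ·) (Pcoll E x : Set (Finset α))) :
    HasBetaCycle (elimStep E x) ↔ HasBetaCycle E := by
  constructor
  · rintro ⟨k, u, F, hu, -, hFE, hinc, hninc⟩
    have hpre : ∀ i, ∃ G ∈ E, G.erase x = F i := fun i =>
      (eq_erase_or_eq_empty_of_mem_elimStep hx (hFE i)).resolve_right
        (Finset.ne_empty_of_mem (hinc i).1)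
    choose G hG hGF using hpre
    have hux : ∀ i, u i ≠ x := fun i h => notMem_of_mem_elimStep (hFE i) (h ▸ (hinc i).1)
    have hmem : ∀ i j, u i ∈ G j ↔ u i ∈ F j := fun i j => by
      rw [← hGF, Finset.mem_erase]
      simp [hux i]
    simp only [← hmem] at hinc hninc
    exact ⟨k, u, G, hu, injective_of_cyclic_incidence hinc hninc, hG, hinc, hninc⟩
  · rintro ⟨k, u, F, hu, -, hFE, hinc, hninc⟩
    have hux : ∀ i, u i ≠ x := by
      rintro i rfl
      have hP : ∀ j, u i ∈ F j → (F j).erase (u i) ∈ (Pcoll E (u i) : Set (Finset α)) :=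
        fun j hj => Finset.mem_coe.2
          (Finset.mem_image_of_mem _ (Finset.mem_filter.2 ⟨hFE j, hj⟩))
      have aux : ∀ j l a, (F j).erase (u i) ⊆ (F l).erase (u i) → u a ∈ F j → a ≠ i →
          u a ∈ F l := fun j l a hsub ha hai =>
        (Finset.mem_erase.1 (hsub (Finset.mem_erase.2 ⟨hu.ne hai, ha⟩))).2
      rcases hx.total (hP i (hinc i).1) (hP (i + 1) (hinc i).2) with h | h
      · have h1 := hinc (i - 1)
        rw [sub_add_cancel] at h1
        refine hninc (i - 1) (i + 1) ?_ ?_ (aux _ _ _ h h1.2 ?_)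
        all_goals
          obtain ⟨j, rfl⟩ : ∃ j, i = j + 1 := ⟨i - 1, by simp⟩
          have := Fin.val_add_one_cyclic j
          have := Fin.val_add_one_cyclic (j + 1)
          rw [add_sub_cancel_right, ne_eq, Fin.ext_iff]
          omega
      · refine hninc (i + 1) i ?_ ?_ (aux _ _ _ h (hinc (i + 1)).1 ?_)
        all_goals
          have := Fin.val_add_one_cyclic i
          have := Fin.val_add_one_cyclic (i + 1)
          rw [ne_eq, Fin.ext_iff]
          omega
    have hmem : ∀ i j, u i ∈ (F j).erase x ↔ u i ∈ F j := fun i j => by simp [hux i]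
    simp only [← hmem] at hinc hninc
    exact ⟨k, u, fun i => (F i).erase x, hu, injective_of_cyclic_incidence hinc hninc,
      fun i => Finset.mem_union_left _ (Finset.mem_image_of_mem _ (hFE i)), hinc, hninc⟩

/-- Every prefix collection encountered when eliminating the list `l` is a chain. -/
def NestedElim (E : Finset (Finset α)) (l : List α) : Prop :=
  ∀ i : Fin l.length, IsChain (· ⊆ ·)
    ((Pcoll (elimList E (l.drop (i.val + 1))) (l.get i) : Finset (Finset α)) : Set (Finset α))

theorem nestedElim_cons {E : Finset (Finset α)} {x : α} {l : List α} :
    NestedElim E (x :: l) ↔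
      IsChain (· ⊆ ·) (Pcoll (elimList E l) x : Set (Finset α)) ∧ NestedElim E l := by
  unfold NestedElim
  constructor
  · exact fun h => ⟨h ⟨0, by simp⟩, fun i => h i.succ⟩
  · rintro ⟨h0, h⟩ i
    exact Fin.cases (motive := fun i : Fin (l.length + 1) => IsChain (· ⊆ ·)
      ((Pcoll (elimList E ((x :: l).drop (i.val + 1))) ((x :: l).get i) : Finset (Finset α)) :
        Set (Finset α))) h0 h i

theorem NestedElim.hasBetaCycle_elimList_iff {E : Finset (Finset α)} {l : List α}
    (h : NestedElim E l) : HasBetaCycle (elimList E l) ↔ HasBetaCycle E := by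
  induction l with
  | nil => rfl
  | cons x l ih =>
    rw [nestedElim_cons] at h
    exact (hasBetaCycle_elimStep_iff h.1).trans (ih h.2)

theorem NestedElim.notMem_of_mem_elimList {E : Finset (Finset α)} {l : List α}
    (h : NestedElim E l) {a : α} (ha : a ∈ l) {F : Finset α} (hF : F ∈ elimList E l) : a ∉ F := by
  induction l generalizing F with
  | nil => simp at ha
  | cons x l ih =>
    rw [nestedElim_cons] at h
    rcases List.mem_cons.1 ha with rfl | ha
    · exact notMem_of_mem_elimStep hF
    · rcases eq_erase_or_eq_empty_of_mem_elimStep h.1 hF with ⟨G, hG, rfl⟩ | rfl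
      · exact fun haG => ih h.2 ha hG (Finset.mem_of_mem_erase haG)
      · simp

theorem BetaAcyclic.exists_nestedElim [Fintype α] {E : Finset (Finset α)} (hE : BetaAcyclic E)
    (n : ℕ) (hn : n ≤ Fintype.card α) :
    ∃ l : List α, l.Nodup ∧ l.length = n ∧ NestedElim E l := by
  induction n with
  | zero => exact ⟨[], List.nodup_nil, rfl, fun i => i.elim0⟩
  | succ n ih =>
    obtain ⟨l, hl, hlen, hnest⟩ := ih (by omega)
    have hS : (l.toFinsetᶜ).Nonempty := by
      rw [← Finset.card_pos, Finset.card_compl, List.toFinset_card_of_nodup hl]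
      omega
    obtain ⟨x, hxS, hx⟩ := BetaAcyclic.exists_isChain_Pcoll
      (mt hnest.hasBetaCycle_elimList_iff.1 hE) hS fun F hF a ha => by
        simpa using fun hal => hnest.notMem_of_mem_elimList hal hF ha
    exact ⟨x :: l, List.nodup_cons.2 ⟨by simpa using hxS, hl⟩, by simp [hlen],
      nestedElim_cons.2 ⟨hx, hnest⟩⟩

/-- A hypergraph is β-acyclic iff there is an ordering `v_1, …, v_n` of all its vertices
which is a nested elimination order, i.e. every prefix collection `P_k` is a chain under
inclusion. -/
theorem stmt_1 [Fintype α] (E : Finset (Finset α)) :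
    BetaAcyclic E ↔
      ∃ l : List α, l.Nodup ∧ (∀ a : α, a ∈ l) ∧
        ∀ i : Fin l.length,
          IsChain (· ⊆ ·)
            ((Pcoll (elimList E (l.drop (i.val + 1))) (l.get i) : Finset (Finset α)) :
              Set (Finset α)) := by
  constructor
  · intro hE
    obtain ⟨l, hl, hlen, hnest⟩ := hE.exists_nestedElim _ le_rfl
    refine ⟨l, hl, fun a => ?_, hnest⟩
    have : l.toFinset = Finset.univ := by
      rw [← Finset.card_eq_iff_eq_univ, List.toFinset_card_of_nodup hl, hlen]
    simpa using this.ge (Finset.mem_univ a)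
  · rintro ⟨l, -, hmem, hnest : NestedElim E l⟩ hcyc
    obtain ⟨k, u, F, -, -, hF, hinc, -⟩ := hnest.hasBetaCycle_elimList_iff.2 hcyc
    exact hnest.notMem_of_mem_elimList (hmem (u 0)) (hF 0) (hinc 0).1
end

section
/- Let c ≥ 4 and let G be a tripartite graph with parts V_1, V_2, V_3 in which every edge joins two distinct parts. Let G′ be obtained from G by replacing each edge {u, v} with u ∈ V_1 and v ∈ V_2 by a path u, w_1^{uv}, …, w_{c−3}^{uv}, v through c − 3 new internal vertices (distinct for different edges), placing the new vertices into c − 3 new parts W_1, …, W_{c−3}. Then G′ is c-partite with parts V_1, W_1, …, W_{c−3}, V_2, V_3, has at most (c − 2) · |E(G)| edges, and G′ contains a cycle of length c with exactly one vertex in each of its c parts if and only if G contains a triangle with one vertex in each of V_1, V_2, V_3. -/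
/-- Vertex set of the subdivided graph `G'`: the original vertices together with, for every
edge of `G` from part `0` (i.e. `V_1`) to part `1` (i.e. `V_2`), a path of `c - 3` new
internal vertices. -/
abbrev SubdivVert {V : Type} (G : SimpleGraph V) (P : V → ℕ) (c : ℕ) : Type :=
  V ⊕ ({p : V × V // G.Adj p.1 p.2 ∧ P p.1 = 0 ∧ P p.2 = 1} × Fin (c - 3))

/-- The subdivided graph `G'`: all original edges except those between parts `0` and `1`
are kept, and every edge `{u, v}` with `P u = 0`, `P v = 1` is replaced by a path
`u, w_1, …, w_{c-3}, v` through its own `c - 3` new internal vertices. -/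
def SubdivGraph {V : Type} (G : SimpleGraph V) (P : V → ℕ) (c : ℕ) :
    SimpleGraph (SubdivVert G P c) :=
  SimpleGraph.fromRel (fun x y =>
    match x, y with
    | Sum.inl u, Sum.inl v =>
        G.Adj u v ∧ ¬(P u = 0 ∧ P v = 1) ∧ ¬(P u = 1 ∧ P v = 0)
    | Sum.inl u, Sum.inr ei =>
        ((ei.2 : ℕ) = 0 ∧ u = ei.1.val.1) ∨ ((ei.2 : ℕ) = c - 4 ∧ u = ei.1.val.2)
    | Sum.inr _, Sum.inl _ => False
    | Sum.inr ei, Sum.inr ej => ei.1 = ej.1 ∧ (ej.2 : ℕ) = (ei.2 : ℕ) + 1)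

/-- The parts of the subdivided graph `G'`, as numbers `< c`: part `V_1` becomes part `0`,
the new parts `W_1, …, W_{c-3}` become parts `1, …, c-3`, part `V_2` becomes part `c-2`,
and part `V_3` becomes part `c-1`. -/
def SubdivParts {V : Type} (G : SimpleGraph V) (P : V → ℕ) (c : ℕ) :
    SubdivVert G P c → ℕ
  | Sum.inl u => if P u = 0 then 0 else if P u = 1 then c - 2 else c - 1
  | Sum.inr ei => (ei.2 : ℕ) + 1

namespace SubdivGraph

variable {V : Type} {G : SimpleGraph V} {P : V → ℕ} {c : ℕ}

/-- The `k`-th vertex of the path replacing the edge `p`; it is the endpoint `p.val.2` for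
every `k ≥ c - 2`. -/
def pathVert (c : ℕ) (p : {p : V × V // G.Adj p.1 p.2 ∧ P p.1 = 0 ∧ P p.2 = 1}) (k : ℕ) :
    SubdivVert G P c :=
  if k = 0 then Sum.inl p.val.1
  else if h : k - 1 < c - 3 then Sum.inr (p, ⟨k - 1, h⟩) else Sum.inl p.val.2

section PathVert

variable (p : {p : V × V // G.Adj p.1 p.2 ∧ P p.1 = 0 ∧ P p.2 = 1})

lemma pathVert_zero : pathVert c p 0 = Sum.inl p.val.1 := by simp [pathVert]

lemma pathVert_succ (i : Fin (c - 3)) : pathVert c p (i + 1) = Sum.inr (p, i) := by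
  simp [pathVert]

lemma pathVert_last (hc : 4 ≤ c) : pathVert c p (c - 2) = Sum.inl p.val.2 := by
  have h0 : c - 2 ≠ 0 := by omega
  have h1 : ¬ c - 2 - 1 < c - 3 := by omega
  simp only [pathVert, if_neg h0, dif_neg h1]

lemma pathVert_cases (hc : 4 ≤ c) {k : ℕ} (hk : k ≤ c - 2) :
    k = 0 ∨ k = c - 2 ∨ ∃ i : Fin (c - 3), k = i + 1 := by
  by_cases h0 : k = 0
  · exact Or.inl h0
  by_cases h1 : k = c - 2
  · exact Or.inr (Or.inl h1)
  · exact Or.inr (Or.inr ⟨⟨k - 1, by omega⟩, by simp only; omega⟩)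

lemma parts_pathVert (hc : 4 ≤ c) {k : ℕ} (hk : k ≤ c - 2) :
    SubdivParts G P c (pathVert c p k) = k := by
  rcases pathVert_cases hc hk with rfl | rfl | ⟨i, rfl⟩
  · rw [pathVert_zero]
    simp [SubdivParts, p.2.2.1]
  · rw [pathVert_last p hc]
    simp [SubdivParts, p.2.2.2]
  · rw [pathVert_succ]
    simp [SubdivParts]

lemma adj_pathVert (hc : 4 ≤ c) {k : ℕ} (hk : k < c - 2) :
    (SubdivGraph G P c).Adj (pathVert c p k) (pathVert c p (k + 1)) := by
  have hne : pathVert c p k ≠ pathVert c p (k + 1) := fun h => by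
    have := congrArg (SubdivParts G P c) h
    rw [parts_pathVert p hc hk.le, parts_pathVert p hc hk] at this
    omega
  refine (SimpleGraph.fromRel_adj _ _ _).2 ⟨hne, ?_⟩
  rcases pathVert_cases hc hk.le with rfl | rfl | ⟨i, rfl⟩
  · left
    rw [pathVert_zero, pathVert_succ p ⟨0, by omega⟩]
    exact Or.inl ⟨rfl, rfl⟩
  · omega
  · rcases pathVert_cases hc (k := i + 1 + 1) hk with h | h | ⟨j, h⟩
    · omega
    · right
      rw [h, pathVert_succ, pathVert_last p hc]
      exact Or.inr ⟨by simp only; omega, rfl⟩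
    · left
      rw [h, pathVert_succ, pathVert_succ]
      exact ⟨rfl, by simp only; omega⟩

lemma adj_inl_inl {u v : V} : (SubdivGraph G P c).Adj (Sum.inl u) (Sum.inl v) ↔
    G.Adj u v ∧ ¬(P u = 0 ∧ P v = 1) ∧ ¬(P u = 1 ∧ P v = 0) := by
  refine (SimpleGraph.fromRel_adj _ _ _).trans ⟨?_, fun h => ⟨?_, Or.inl h⟩⟩
  · rintro ⟨-, h | ⟨h1, h2, h3⟩⟩
    · exact h
    · exact ⟨h1.symm, fun h => h3 h.symm, fun h => h2 h.symm⟩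
  · simpa using h.1.ne

lemma exists_pathVert_of_adj_inr (hc : 4 ≤ c) {x : SubdivVert G P c} {i : Fin (c - 3)}
    (h : (SubdivGraph G P c).Adj (Sum.inr (p, i)) x) :
    x = pathVert c p i ∨ x = pathVert c p (i + 2) := by
  obtain ⟨-, h⟩ := (SimpleGraph.fromRel_adj _ _ _).1 h
  rcases x with u | ⟨q, j⟩
  · rcases h with h | ⟨h0, hu⟩ | ⟨h0, hu⟩
    · exact h.elim
    · left
      simp only at h0 hu
      rw [h0, pathVert_zero, hu]
    · right
      simp only at h0 hu
      rw [show (i : ℕ) + 2 = c - 2 by omega, pathVert_last p hc, hu]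
  · rcases h with ⟨h0, hu⟩ | ⟨h0, hu⟩
    · right
      simp only at h0 hu
      subst h0
      rw [show (i : ℕ) + 2 = j + 1 by omega, pathVert_succ]
    · left
      simp only at h0 hu
      subst h0
      rw [hu, pathVert_succ]

lemma adj_cases (hc : 4 ≤ c) {x y : SubdivVert G P c} (h : (SubdivGraph G P c).Adj x y) :
    (∃ u v, x = Sum.inl u ∧ y = Sum.inl v ∧
      G.Adj u v ∧ ¬(P u = 0 ∧ P v = 1) ∧ ¬(P u = 1 ∧ P v = 0)) ∨
    ∃ p k, k < c - 2 ∧ (x = pathVert c p k ∧ y = pathVert c p (k + 1) ∨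
      x = pathVert c p (k + 1) ∧ y = pathVert c p k) := by
  rcases x with u | ⟨p, i⟩
  · rcases y with v | ⟨p, i⟩
    · exact Or.inl ⟨u, v, rfl, rfl, adj_inl_inl.1 h⟩
    · rcases exists_pathVert_of_adj_inr p hc h.symm with h | h
      · exact Or.inr ⟨p, i, by omega, Or.inl ⟨h, (pathVert_succ p i).symm⟩⟩
      · exact Or.inr ⟨p, i + 1, by omega, Or.inr ⟨h, (pathVert_succ p i).symm⟩⟩
  · rcases exists_pathVert_of_adj_inr p hc h with h | h
    · exact Or.inr ⟨p, i, by omega, Or.inr ⟨(pathVert_succ p i).symm, h⟩⟩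
    · exact Or.inr ⟨p, i + 1, by omega, Or.inl ⟨(pathVert_succ p i).symm, h⟩⟩

lemma parts_lt (hc : 4 ≤ c) (x : SubdivVert G P c) : SubdivParts G P c x < c := by
  rcases x with u | ⟨p, i⟩ <;> simp only [SubdivParts]
  · split_ifs <;> omega
  · omega

lemma parts_ne_of_adj (hc : 4 ≤ c) (hP3 : ∀ v, P v < 3)
    (hPadj : ∀ u v, G.Adj u v → P u ≠ P v) {x y : SubdivVert G P c}
    (h : (SubdivGraph G P c).Adj x y) : SubdivParts G P c x ≠ SubdivParts G P c y := by
  rcases adj_cases hc h with ⟨u, v, rfl, rfl, huv, -, -⟩ | ⟨p, k, hk, ⟨rfl, rfl⟩ | ⟨rfl, rfl⟩⟩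
  · have := hPadj u v huv
    have := hP3 u
    have := hP3 v
    simp only [SubdivParts]
    split_ifs <;> omega
  · rw [parts_pathVert p hc hk.le, parts_pathVert p hc hk]
    omega
  · rw [parts_pathVert p hc hk.le, parts_pathVert p hc hk]
    omega

open Classical in
/-- The `k`-th edge of `SubdivGraph G P c` that arises from the edge `e` of `G`. -/
noncomputable def subdivEdge (G : SimpleGraph V) (P : V → ℕ) (c : ℕ) (e : Sym2 V) (k : ℕ) :
    Sym2 (SubdivVert G P c) :=
  if h : ∃ p : {p : V × V // G.Adj p.1 p.2 ∧ P p.1 = 0 ∧ P p.2 = 1}, s(p.val.1, p.val.2) = e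
  then s(pathVert c h.choose k, pathVert c h.choose (k + 1)) else e.map Sum.inl

lemma subdivEdge_mk (k : ℕ) : subdivEdge G P c s(p.val.1, p.val.2) k =
    s(pathVert c p k, pathVert c p (k + 1)) := by
  have h : ∃ q : {p : V × V // G.Adj p.1 p.2 ∧ P p.1 = 0 ∧ P p.2 = 1},
      s(q.val.1, q.val.2) = s(p.val.1, p.val.2) := ⟨p, rfl⟩
  have hp : h.choose = p := by
    rcases Sym2.eq_iff.1 h.choose_spec with ⟨h1, h2⟩ | ⟨h1, -⟩
    · exact Subtype.ext (Prod.ext h1 h2)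
    · have := h.choose.2.2.1
      rw [h1, p.2.2.2] at this
      omega
  rw [subdivEdge, dif_pos h, hp]

lemma subdivEdge_of_kept {u v : V} (h1 : ¬(P u = 0 ∧ P v = 1)) (h2 : ¬(P u = 1 ∧ P v = 0))
    (k : ℕ) : subdivEdge G P c s(u, v) k = s(Sum.inl u, Sum.inl v) := by
  rw [subdivEdge, dif_neg, Sym2.map_mk]
  rintro ⟨⟨⟨a, b⟩, _, ha, hb⟩, hab⟩
  rcases Sym2.eq_iff.1 hab with ⟨rfl, rfl⟩ | ⟨rfl, rfl⟩
  · exact h1 ⟨ha, hb⟩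
  · exact h2 ⟨hb, ha⟩

lemma ncard_edgeSet_le [Finite V] (hc : 4 ≤ c) :
    (SubdivGraph G P c).edgeSet.ncard ≤ (c - 2) * G.edgeSet.ncard := by
  have hfin : (G.edgeSet ×ˢ Set.Iio (c - 2)).Finite :=
    (Set.toFinite _).prod (Set.finite_Iio _)
  have hsub : (SubdivGraph G P c).edgeSet ⊆
      (fun a => subdivEdge G P c a.1 a.2) '' (G.edgeSet ×ˢ Set.Iio (c - 2)) := by
    intro e he
    induction e using Sym2.ind with
    | _ x y =>
      rcases adj_cases hc ((SimpleGraph.mem_edgeSet _).1 he) with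
        ⟨u, v, rfl, rfl, huv, h1, h2⟩ | ⟨p, k, hk, h⟩
      · refine ⟨(s(u, v), 0), ⟨huv, ?_⟩, subdivEdge_of_kept h1 h2 0⟩
        simp only [Set.mem_Iio]
        omega
      · refine ⟨(s(p.val.1, p.val.2), k), ⟨p.2.1, hk⟩, (subdivEdge_mk p k).trans ?_⟩
        rcases h with ⟨rfl, rfl⟩ | ⟨rfl, rfl⟩
        · rfl
        · exact Sym2.eq_swap
  calc (SubdivGraph G P c).edgeSet.ncard
      ≤ _ := Set.ncard_le_ncard hsub (hfin.image _)
    _ ≤ (G.edgeSet ×ˢ Set.Iio (c - 2)).ncard := Set.ncard_image_le hfin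
    _ = (c - 2) * G.edgeSet.ncard := by
      rw [Set.ncard_prod, mul_comm, ← Finset.coe_Iio, Set.ncard_coe_finset, Nat.card_Iio]

/-- A set of vertices of `SubdivGraph G P c` that meets every part in at most one vertex, meets
the parts `1` and `c - 1`, and in which every vertex has two neighbours yields a triangle. -/
lemma exists_triangle (hc : 4 ≤ c) (hP3 : ∀ v, P v < 3)
    (hPadj : ∀ u v, G.Adj u v → P u ≠ P v) {S : Set (SubdivVert G P c)}
    (hS : S.InjOn (SubdivParts G P c))
    (hdeg : ∀ x ∈ S, ∃ y ∈ S, ∃ z ∈ S, y ≠ z ∧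
      (SubdivGraph G P c).Adj x y ∧ (SubdivGraph G P c).Adj x z)
    (h1 : ∃ x ∈ S, SubdivParts G P c x = 1) (hlast : ∃ x ∈ S, SubdivParts G P c x = c - 1) :
    ∃ u v w : V, P u = 0 ∧ P v = 1 ∧ P w = 2 ∧ G.Adj u v ∧ G.Adj v w ∧ G.Adj u w := by
  obtain ⟨x, hx, hx1⟩ := h1
  obtain ⟨p, rfl⟩ : ∃ p, x = pathVert c p 1 := by
    rcases x with u | ⟨p, i⟩
    · simp only [SubdivParts] at hx1
      split_ifs at hx1 <;> omega
    · simp only [SubdivParts] at hx1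
      exact ⟨p, by rw [← pathVert_succ, hx1]⟩
  have hnbr (i : Fin (c - 3)) (hi : pathVert c p (i + 1) ∈ S) :
      pathVert c p i ∈ S ∧ pathVert c p (i + 2) ∈ S := by
    obtain ⟨y, hy, z, hz, hyz, hxy, hxz⟩ := hdeg _ hi
    rw [pathVert_succ] at hxy hxz
    rcases exists_pathVert_of_adj_inr p hc hxy with rfl | rfl <;>
      rcases exists_pathVert_of_adj_inr p hc hxz with rfl | rfl
    · exact (hyz rfl).elim
    · exact ⟨hy, hz⟩
    · exact ⟨hz, hy⟩
    · exact (hyz rfl).elim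
  have hmem : ∀ k, k < c - 2 → pathVert c p (k + 1) ∈ S := by
    intro k
    induction k with
    | zero => exact fun _ => hx
    | succ k ih => exact fun hk => (hnbr ⟨k, by omega⟩ (ih (by omega))).2
  have hzero := (hnbr ⟨0, by omega⟩ hx).1
  have hend := hmem (c - 3) (by omega)
  rw [show c - 3 + 1 = c - 2 by omega] at hend
  obtain ⟨x, hx, hxl⟩ := hlast
  obtain ⟨w, rfl, hw⟩ : ∃ w, x = Sum.inl w ∧ P w = 2 := by
    rcases x with w | ⟨q, i⟩
    · refine ⟨w, rfl, ?_⟩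
      have := hP3 w
      simp only [SubdivParts] at hxl
      split_ifs at hxl <;> omega
    · simp only [SubdivParts] at hxl
      omega
  have hadj {y : SubdivVert G P c} (hy : y ∈ S) (h : (SubdivGraph G P c).Adj (Sum.inl w) y) :
      ∃ v, y = Sum.inl v ∧ G.Adj v w ∧ (v = p.val.1 ∨ v = p.val.2) := by
    rcases y with v | ⟨q, i⟩
    · have hvw := (adj_inl_inl.1 h).1.symm
      refine ⟨v, rfl, hvw, ?_⟩
      have := hPadj v w hvw
      have := hP3 v
      by_cases h0 : P v = 0
      · left
        refine Sum.inl_injective (hS hy (pathVert_zero p ▸ hzero) ?_)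
        simp [SubdivParts, h0, p.2.2.1]
      · right
        refine Sum.inl_injective (hS hy (pathVert_last p hc ▸ hend) ?_)
        simp [SubdivParts, show P v = 1 by omega, p.2.2.2]
    · have hq := q.2.2
      rcases (SimpleGraph.fromRel_adj _ _ _).1 h with ⟨-, (⟨-, rfl⟩ | ⟨-, rfl⟩) | h⟩
      · simp only at hw
        omega
      · simp only at hw
        omega
      · exact h.elim
  obtain ⟨y, hy, z, hz, hyz, hxy, hxz⟩ := hdeg _ hx
  obtain ⟨a, rfl, haw, ha⟩ := hadj hy hxy
  obtain ⟨b, rfl, hbw, hb⟩ := hadj hz hxz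
  refine ⟨p.val.1, p.val.2, w, p.2.2.1, p.2.2.2, hw, p.2.1, ?_⟩
  rcases ha with rfl | rfl <;> rcases hb with rfl | rfl
  · exact (hyz rfl).elim
  · exact ⟨hbw, haw⟩
  · exact ⟨haw, hbw⟩
  · exact (hyz rfl).elim

end PathVert

lemma val_add_one (h1 : 1 < c) (j : Fin c) :
    ((j + ⟨1, h1⟩ : Fin c) : ℕ) = (if (j : ℕ) = c - 1 then 0 else (j : ℕ) + 1 : ℕ) := by
  rw [Fin.val_add]
  split_ifs with h
  · simp only [h]
    rw [show c - 1 + 1 = c by omega, Nat.mod_self]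
  · exact Nat.mod_eq_of_lt (by simp only; omega)

lemma exists_triangle_of_cycle (hc : 4 ≤ c) (h1 : 1 < c) (hP3 : ∀ v, P v < 3)
    (hPadj : ∀ u v, G.Adj u v → P u ≠ P v) {f : Fin c → SubdivVert G P c}
    (hf : ∀ j : Fin c, (SubdivGraph G P c).Adj (f j) (f (j + ⟨1, h1⟩)))
    (hparts : ∀ i : ℕ, i < c → ∃! j : Fin c, SubdivParts G P c (f j) = i) :
    ∃ u v w : V, P u = 0 ∧ P v = 1 ∧ P w = 2 ∧ G.Adj u v ∧ G.Adj v w ∧ G.Adj u w := by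
  have hinj {i j : Fin c} (h : SubdivParts G P c (f i) = SubdivParts G P c (f j)) : i = j :=
    (hparts _ (parts_lt hc _)).unique h rfl
  refine exists_triangle hc hP3 hPadj (S := Set.range f) ?_ ?_ ?_ ?_
  · rintro _ ⟨i, rfl⟩ _ ⟨j, rfl⟩ h
    rw [hinj h]
  · rintro _ ⟨j, rfl⟩
    obtain ⟨i, rfl⟩ : ∃ i : Fin c, i + ⟨1, h1⟩ = j := by
      refine ⟨⟨if (j : ℕ) = 0 then c - 1 else j - 1, by split_ifs <;> omega⟩, Fin.ext ?_⟩
      rw [val_add_one h1]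
      simp only
      split_ifs <;> omega
    refine ⟨_, ⟨i, rfl⟩, _, ⟨i + ⟨1, h1⟩ + ⟨1, h1⟩, rfl⟩, fun h => ?_,
      (hf i).symm, hf _⟩
    have := congrArg Fin.val (hinj (congrArg _ h))
    rw [val_add_one h1, val_add_one h1] at this
    split_ifs at this <;> omega
  · obtain ⟨j, hj, -⟩ := hparts 1 (by omega)
    exact ⟨_, ⟨j, rfl⟩, hj⟩
  · obtain ⟨j, hj, -⟩ := hparts (c - 1) (by omega)
    exact ⟨_, ⟨j, rfl⟩, hj⟩

lemma exists_cycle_of_triangle (hc : 4 ≤ c) (h1 : 1 < c) {u v w : V} (hu : P u = 0) (hv : P v = 1)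
    (hw : P w = 2) (huv : G.Adj u v) (hvw : G.Adj v w) (huw : G.Adj u w) :
    ∃ f : Fin c → SubdivVert G P c,
      (∀ j : Fin c, (SubdivGraph G P c).Adj (f j) (f (j + ⟨1, h1⟩))) ∧
      (∀ i : ℕ, i < c → ∃! j : Fin c, SubdivParts G P c (f j) = i) := by
  let p : {p : V × V // G.Adj p.1 p.2 ∧ P p.1 = 0 ∧ P p.2 = 1} := ⟨(u, v), huv, hu, hv⟩
  let g : ℕ → SubdivVert G P c := fun k => if k = c - 1 then Sum.inl w else pathVert c p k
  have hg : ∀ k < c, SubdivParts G P c (g k) = k := by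
    intro k hk
    by_cases h : k = c - 1
    · simp [g, h, SubdivParts, hw]
    · simp only [g, if_neg h]
      exact parts_pathVert p hc (by omega)
  refine ⟨fun j => g j, fun j => ?_, fun i hi => ⟨⟨i, hi⟩, hg i hi, fun j hj => ?_⟩⟩
  · simp only [val_add_one h1]
    have hj := j.2
    split_ifs with h
    · have h0 : 0 ≠ c - 1 := by omega
      simp only [g, if_pos h, if_neg h0, pathVert_zero]
      exact adj_inl_inl.2 ⟨huw.symm, by omega, by omega⟩
    · simp only [g, if_neg h]
      split_ifs with h'
      · rw [show (j : ℕ) = c - 2 by omega, pathVert_last p hc]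
        exact adj_inl_inl.2 ⟨hvw, by simp only [p]; omega, by simp only [p]; omega⟩
      · exact adj_pathVert p hc (by omega)
  · exact Fin.ext ((hg j j.2).symm.trans hj)

end SubdivGraph

/-- Subdividing the `V_1`–`V_2` edges of a tripartite graph `G` into paths of length `c - 2`
gives a `c`-partite graph `G'` with at most `(c-2)·|E(G)|` edges, which has a `c`-cycle with
exactly one vertex in each of its `c` parts iff `G` has a triangle with one vertex in each
of `V_1, V_2, V_3`. -/
theorem stmt_9 (c : ℕ) (hc : 4 ≤ c) (V : Type) [Fintype V] (G : SimpleGraph V)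
    (P : V → ℕ) (hP3 : ∀ v, P v < 3) (hPadj : ∀ u v, G.Adj u v → P u ≠ P v) :
    (∀ x, SubdivParts G P c x < c) ∧
    (∀ x y, (SubdivGraph G P c).Adj x y → SubdivParts G P c x ≠ SubdivParts G P c y) ∧
    ((SubdivGraph G P c).edgeSet.ncard ≤ (c - 2) * G.edgeSet.ncard) ∧
    ((∃ f : Fin c → SubdivVert G P c,
        (∀ j : Fin c, (SubdivGraph G P c).Adj (f j) (f (j + ⟨1, by omega⟩))) ∧
        (∀ i : ℕ, i < c → ∃! j : Fin c, SubdivParts G P c (f j) = i)) ↔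
      (∃ u v w : V, P u = 0 ∧ P v = 1 ∧ P w = 2 ∧
        G.Adj u v ∧ G.Adj v w ∧ G.Adj u w)) := by
  exact ⟨SubdivGraph.parts_lt hc, fun _ _ => SubdivGraph.parts_ne_of_adj hc hP3 hPadj,
    SubdivGraph.ncard_edgeSet_le hc,
    fun ⟨_, hf, hparts⟩ => SubdivGraph.exists_triangle_of_cycle hc _ hP3 hPadj hf hparts,
    fun ⟨_, _, _, hu, hv, hw, huv, hvw, huw⟩ =>
      SubdivGraph.exists_cycle_of_triangle hc _ hu hv hw huv hvw huw⟩
end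

section
/- Suppose the hypergraph of the natural join query Q is β-acyclic. Then there exists a GAO A_1, …, A_n with the following property: for every k ∈ [n] and every tuple (t_1, …, t_{k−1}) ∈ ℕ^{k−1}, any collection of patterns of length k − 1, each of which generalizes (t_1, …, t_{k−1}) and whose support is either the full set {1, …, k−1} or equals the set of positions in {1, …, k−1} of the attributes of some relation R ∈ atoms(Q) with A_k among the attributes of R, is totally ordered (a chain) under the specialization order. -/
variable {α : Type*} [DecidableEq α]

/-- If exchanging the positions of two points never increases a sum weighted by increasing weights,
then the summands are sorted. -/
lemma le_of_forall_sum_weight_le {X : Type*} [Fintype X] {n : ℕ} (N : X → ℕ) (e : X ≃ Fin n)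
    (hmax : ∀ e' : X ≃ Fin n, ∑ x, 2 ^ (e' x).val * N x ≤ ∑ x, 2 ^ (e x).val * N x)
    {x x' : X} (hlt : e x < e x') : N x ≤ N x' := by
  classical
  have hne : x ≠ x' := by
    rintro rfl
    exact lt_irrefl _ hlt
  have h := hmax ((Equiv.swap x x').trans e)
  have hsplit : ∀ g : X → ℕ, ∑ z, g z = g x + g x' + ∑ z ∈ ({x, x'} : Finset X)ᶜ, g z := by
    intro g
    rw [← Finset.sum_add_sum_compl ({x, x'} : Finset X), Finset.sum_pair hne]
  rw [hsplit, hsplit (fun z => 2 ^ (e z).val * N z)] at h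
  have hrest : ∑ z ∈ ({x, x'} : Finset X)ᶜ, 2 ^ (((Equiv.swap x x').trans e) z).val * N z
      = ∑ z ∈ ({x, x'} : Finset X)ᶜ, 2 ^ (e z).val * N z := by
    refine Finset.sum_congr rfl fun z hz => ?_
    simp only [Finset.mem_compl, Finset.mem_insert, Finset.mem_singleton, not_or] at hz
    rw [Equiv.trans_apply, Equiv.swap_apply_of_ne_of_ne hz.1 hz.2]
  rw [hrest] at h
  simp only [Equiv.trans_apply, Equiv.swap_apply_left, Equiv.swap_apply_right] at h
  have hpow : 2 ^ (e x).val < 2 ^ (e x').val := Nat.pow_lt_pow_right (by norm_num) hlt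
  by_contra! hN
  nlinarith

/-- Every finite relation admits a doubly lexical ordering. -/
lemma exists_doubly_lexical_order {X Y : Type*} [Fintype X] [Fintype Y]
    (R : X → Y → Prop) [∀ x y, Decidable (R x y)] :
    ∃ (e : X ≃ Fin (Fintype.card X)) (f : Y ≃ Fin (Fintype.card Y)),
      (∀ x x', e x < e x' → ∑ y with R x y, 2 ^ (f y).val ≤ ∑ y with R x' y, 2 ^ (f y).val) ∧
      (∀ y y', f y < f y' → ∑ x with R x y, 2 ^ (e x).val ≤ ∑ x with R x y', 2 ^ (e x).val) := by
  classical
  let Φ : (X ≃ Fin (Fintype.card X)) × (Y ≃ Fin (Fintype.card Y)) → ℕ := fun p =>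
    ∑ x, 2 ^ (p.1 x).val * ∑ y with R x y, 2 ^ (p.2 y).val
  have hΦ : ∀ p, Φ p = ∑ y, 2 ^ (p.2 y).val * ∑ x with R x y, 2 ^ (p.1 x).val := by
    intro p
    simp only [Φ, Finset.mul_sum, Finset.sum_filter]
    rw [Finset.sum_comm]
    refine Finset.sum_congr rfl fun y _ => Finset.sum_congr rfl fun x _ => ?_
    split_ifs
    · ring
    · simp
  have : Nonempty ((X ≃ Fin (Fintype.card X)) × (Y ≃ Fin (Fintype.card Y))) :=
    ⟨(Fintype.equivFin X, Fintype.equivFin Y)⟩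
  obtain ⟨⟨e, f⟩, hmax⟩ := Finite.exists_max Φ
  refine ⟨e, f, fun x x' h => ?_, fun y y' h => ?_⟩
  · exact le_of_forall_sum_weight_le (fun x => ∑ y with R x y, 2 ^ (f y).val) e
      (fun e' => hmax (e', f)) h
  · refine le_of_forall_sum_weight_le (fun y => ∑ x with R x y, 2 ^ (e x).val) f
      (fun f' => ?_) h
    have := hmax (e, f')
    rwa [hΦ, hΦ] at this

/-- Comparing two sets by their binary codes: a point of the first set missing from the second
lies below the largest point at which the sets differ, and that point belongs to the second. -/
lemma exists_last_difference {Y : Type*} [Fintype Y] (f : Y → ℕ) (hf : Function.Injective f)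
    (P Q : Y → Prop) [DecidablePred P] [DecidablePred Q]
    (hle : ∑ y with P y, 2 ^ f y ≤ ∑ y with Q y, 2 ^ f y) {y : Y} (hP : P y) (hQ : ¬ Q y) :
    ∃ z, f y < f z ∧ ¬ P z ∧ Q z ∧ ∀ w, f z < f w → (P w ↔ Q w) := by
  classical
  have hmap : ∀ (S : Y → Prop) [DecidablePred S],
      ∑ y with S y, 2 ^ f y = ∑ i ∈ (Finset.univ.filter S).map ⟨f, hf⟩, 2 ^ i := by
    intro S _
    simp
  rw [hmap P, hmap Q, Finset.geomSum_le_geomSum_iff_toColex_le_toColex le_rfl,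
    Finset.Colex.toColex_le_toColex] at hle
  obtain ⟨z, hz, hzmax⟩ := Finset.exists_max_image
    (Finset.univ.filter fun w => ¬ (P w ↔ Q w)) f ⟨y, by simp [hP, hQ]⟩
  simp only [Finset.mem_filter, Finset.mem_univ, true_and] at hz hzmax
  have hzQ : ¬ (P z ∧ ¬ Q z) := by
    rintro ⟨hPz, hQz⟩
    obtain ⟨b, hb, hb', hzb⟩ := hle (a := f z) (by simp [hPz])
      (by simp [hQz])
    simp only [Finset.mem_map, Finset.mem_filter, Finset.mem_univ, true_and,
      Function.Embedding.coeFn_mk, not_exists, not_and] at hb hb'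
    obtain ⟨w, hw, rfl⟩ := hb
    have hPw : ¬ P w := fun h => hb' w h rfl
    have : f w ≤ f z := hzmax w (by tauto)
    exact hPw (hf (le_antisymm this hzb) ▸ hPz)
  have hyz := hzmax y (by tauto)
  refine ⟨z, lt_of_le_of_ne hyz fun h => ?_, by tauto, by tauto, fun w hw => ?_⟩
  · have := hf h
    subst this
    tauto
  · by_contra h
    exact absurd (hzmax w h) (not_le.2 hw)

/-- Rows `r 0, …, r (k - 1)` and columns `c 0, …, c (k - 1)` of a relation forming a chordless path
that is bent at its middle link `r 0`, `c 0`, and is increasing in both directions; all later rows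
agree on all columns but the last, and all later columns agree on all rows but the last. -/
structure BentPath {X Y : Type*} (R : X → Y → Prop) (e : X → ℕ) (f : Y → ℕ)
    (k : ℕ) (r : ℕ → X) (c : ℕ → Y) : Prop where
  rel : ∀ i j, i < k → j < k → (R (r i) (c j) ↔ (i = 0 ∧ j = 0) ∨ i = j + 1 ∨ j = i + 1)
  row_lt : ∀ i j, i < j → j < k → e (r i) < e (r j)
  col_lt : ∀ i j, i < j → j < k → f (c i) < f (c j)
  row_agree : ∀ x, e (r (k - 1)) < e x → ∀ i j, i + 1 < k → j + 1 < k → (R x (c i) ↔ R x (c j))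
  col_agree : ∀ y, f (c (k - 1)) < f y → ∀ i j, i + 1 < k → j + 1 < k → (R (r i) y ↔ R (r j) y)

/-- A bent path closed by a link between its two ends is a β-cycle. -/
lemma hasBetaCycle_of_closed_path {E : Finset (Finset α)} {k : ℕ} (hk : 2 ≤ k)
    (r : ℕ → Finset α) (c : ℕ → α) (hr : ∀ i, r i ∈ E)
    (hrinj : ∀ i j, i ≤ k → j ≤ k → r i = r j → i = j)
    (hcinj : ∀ i j, i ≤ k → j ≤ k → c i = c j → i = j)
    (hrel : ∀ i j, i ≤ k → j ≤ k →
      (c j ∈ r i ↔ (i = 0 ∧ j = 0) ∨ (i = k ∧ j = k) ∨ i = j + 1 ∨ j = i + 1)) :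
    HasBetaCycle E := by
  obtain ⟨k, rfl⟩ := Nat.exists_eq_add_of_le' hk
  let l : ℕ → ℕ := fun p => if p ≤ k + 2 then p else 2 * (k + 2) + 1 - p
  have hl : ∀ p, p < 2 * (k + 3) → l p ≤ k + 2 := by
    intro p hp
    simp only [l]
    split_ifs <;> omega
  have hmem : ∀ i j : Fin (k + 3), c (l (2 * i.val + 1)) ∈ r (l (2 * j.val)) ↔
      j = i ∨ j = i + 1 := by
    intro i j
    have hsucc : (i.val = k + 2 ∧ (i + 1).val = 0) ∨
        (i.val ≠ k + 2 ∧ (i + 1).val = i.val + 1) := by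
      rw [Fin.val_add_one]
      simp only [Fin.ext_iff, Fin.val_last]
      split_ifs <;> simp [*]
    rw [hrel _ _ (hl _ (by omega)) (hl _ (by omega)), Fin.ext_iff, Fin.ext_iff]
    generalize (i + 1).val = s at hsucc ⊢
    simp only [l]
    split_ifs <;> (try simp only [and_false, false_or]) <;> omega
  refine ⟨k, fun i => c (l (2 * i.val + 1)), fun i => r (l (2 * i.val)), ?_, ?_, fun i => hr _,
    fun i => ⟨(hmem i i).2 (Or.inl rfl), (hmem i (i + 1)).2 (Or.inr rfl)⟩,
    fun i j h1 h2 h => ((hmem i j).1 h).elim h1 h2⟩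
  · intro i j h
    have := hcinj _ _ (hl _ (by omega)) (hl _ (by omega)) h
    simp only [l] at this
    ext
    split_ifs at this <;> omega
  · intro i j h
    have := hrinj _ _ (hl _ (by omega)) (hl _ (by omega)) h
    simp only [l] at this
    ext
    split_ifs at this <;> omega

/-- In a doubly lexically ordered relation a bent path can be prolonged at both ends. -/
lemma BentPath.exists_prolongation {X Y : Type*} {R : X → Y → Prop} {e : X → ℕ} {f : Y → ℕ}
    (hrow : ∀ x x' y, e x < e x' → R x y → ¬ R x' y →
      ∃ z, f y < f z ∧ ¬ R x z ∧ R x' z ∧ ∀ w, f z < f w → (R x w ↔ R x' w))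
    (hcol : ∀ y y' x, f y < f y' → R x y → ¬ R x y' →
      ∃ z, e x < e z ∧ ¬ R z y ∧ R z y' ∧ ∀ w, e z < e w → (R w y ↔ R w y'))
    {k : ℕ} (hk : 2 ≤ k) {r : ℕ → X} {c : ℕ → Y} (h : BentPath R e f k r c) :
    ∃ x y, (R x y → ∃ r' : ℕ → X, ∃ c' : ℕ → Y,
        (∀ i j, i < j → j ≤ k → e (r' i) < e (r' j)) ∧
        (∀ i j, i < j → j ≤ k → f (c' i) < f (c' j)) ∧
        (∀ i j, i ≤ k → j ≤ k → (R (r' i) (c' j) ↔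
          (i = 0 ∧ j = 0) ∨ (i = k ∧ j = k) ∨ i = j + 1 ∨ j = i + 1))) ∧
      (¬ R x y → ∃ r' : ℕ → X, ∃ c' : ℕ → Y, BentPath R e f (k + 1) r' c') := by
  obtain ⟨m, rfl⟩ := Nat.exists_eq_add_of_le' hk
  obtain ⟨hrel, hr, hc, hra, hca⟩ := h
  simp only [Nat.add_succ_sub_one] at hra hca
  obtain ⟨x, hx1, hx2, hx3, hx4⟩ := hcol (c m) (c (m + 1)) (r (m + 1))
    (hc _ _ (by omega) (by omega)) ((hrel _ _ (by omega) (by omega)).2 (by omega))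
    (fun h => absurd ((hrel _ _ (by omega) (by omega)).1 h) (by omega))
  obtain ⟨y, hy1, hy2, hy3, hy4⟩ := hrow (r m) (r (m + 1)) (c (m + 1))
    (hr _ _ (by omega) (by omega)) ((hrel _ _ (by omega) (by omega)).2 (by omega))
    (fun h => absurd ((hrel _ _ (by omega) (by omega)).1 h) (by omega))
  have hxm : ∀ j, j ≤ m → ¬ R x (c j) := fun j hj h =>
    hx2 ((hra x hx1 j m (by omega) (by omega)).1 h)
  have hym : ∀ j, j ≤ m → ¬ R (r j) y := fun j hj h =>
    hy2 ((hca y hy1 j m (by omega) (by omega)).1 h)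
  let r' : ℕ → X := fun i => if i < m + 2 then r i else x
  let c' : ℕ → Y := fun i => if i < m + 2 then c i else y
  have r'_of_lt : ∀ i, i < m + 2 → r' i = r i := fun i hi => if_pos hi
  have c'_of_lt : ∀ i, i < m + 2 → c' i = c i := fun i hi => if_pos hi
  have r'_last : r' (m + 2) = x := if_neg (by omega)
  have c'_last : c' (m + 2) = y := if_neg (by omega)
  have hr' : ∀ i j, i < j → j ≤ m + 2 → e (r' i) < e (r' j) := by
    intro i j hij hj
    rw [r'_of_lt i (by omega)]
    rcases hj.lt_or_eq with hj | rfl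
    · rw [r'_of_lt j hj]
      exact hr i j hij hj
    · rw [r'_last]
      rcases (Nat.lt_succ_iff.1 hij).lt_or_eq with hi | rfl
      · exact (hr i (m + 1) hi (by omega)).trans hx1
      · exact hx1
  have hc' : ∀ i j, i < j → j ≤ m + 2 → f (c' i) < f (c' j) := by
    intro i j hij hj
    rw [c'_of_lt i (by omega)]
    rcases hj.lt_or_eq with hj | rfl
    · rw [c'_of_lt j hj]
      exact hc i j hij hj
    · rw [c'_last]
      rcases (Nat.lt_succ_iff.1 hij).lt_or_eq with hi | rfl
      · exact (hc i (m + 1) hi (by omega)).trans hy1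
      · exact hy1
  have hrel' : ∀ i j, i ≤ m + 2 → j ≤ m + 2 → (R (r' i) (c' j) ↔
      (i = 0 ∧ j = 0) ∨ (i = m + 2 ∧ j = m + 2 ∧ R x y) ∨ i = j + 1 ∨ j = i + 1) := by
    intro i j hi hj
    rcases hi.lt_or_eq with hi | rfl <;> rcases hj.lt_or_eq with hj | rfl
    · rw [r'_of_lt i hi, c'_of_lt j hj, hrel i j hi hj]
      omega
    · rw [r'_of_lt i hi, c'_last]
      rcases (Nat.lt_succ_iff.1 hi).lt_or_eq with hi' | rfl
      · exact iff_of_false (hym i (by omega)) (by omega)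
      · exact iff_of_true hy3 (by omega)
    · rw [c'_of_lt j hj, r'_last]
      rcases (Nat.lt_succ_iff.1 hj).lt_or_eq with hj' | rfl
      · exact iff_of_false (hxm j (by omega)) (by omega)
      · exact iff_of_true hx3 (by omega)
    · rw [r'_last, c'_last]
      simp
  refine ⟨x, y, fun hxy => ⟨r', c', hr', hc', fun i j hi hj => ?_⟩,
    fun hxy => ⟨r', c', ⟨fun i j hi hj => ?_, fun i j hij hj => hr' i j hij (by omega),
      fun i j hij hj => hc' i j hij (by omega), ?_, ?_⟩⟩⟩
  · rw [hrel' i j hi hj]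
    simp [hxy]
  · rw [hrel' i j (by omega) (by omega)]
    simp [hxy]
  · intro w hw
    simp only [Nat.add_succ_sub_one, r'_last] at hw
    have key : ∀ i, i < m + 2 → (R w (c' i) ↔ R w (c m)) := by
      intro i hi
      rw [c'_of_lt i hi]
      rcases (Nat.lt_succ_iff.1 hi).lt_or_eq with hi' | rfl
      · exact hra w (hx1.trans hw) i m (by omega) (by omega)
      · exact (hx4 w hw).symm
    intro i j hi hj
    rw [key i (by omega), key j (by omega)]
  · intro w hw
    simp only [Nat.add_succ_sub_one, c'_last] at hw
    have key : ∀ i, i < m + 2 → (R (r' i) w ↔ R (r m) w) := by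
      intro i hi
      rw [r'_of_lt i hi]
      rcases (Nat.lt_succ_iff.1 hi).lt_or_eq with hi' | rfl
      · exact hca w (hy1.trans hw) i m (by omega) (by omega)
      · exact (hy4 w hw).symm
    intro i j hi hj
    rw [key i (by omega), key j (by omega)]

/-- A β-acyclic hypergraph has orderings of its vertices and of its edges for which the incidence
relation is `Γ`-free. -/
lemma BetaAcyclic.exists_gamma_free_order [Fintype α] {E : Finset (Finset α)}
    (hacyc : BetaAcyclic E) :
    ∃ (e : E → ℕ) (f : α ≃ Fin (Fintype.card α)), Function.Injective e ∧
      ∀ (F G : E) (v w : α), e F < e G → f v < f w → v ∈ F.1 → w ∈ F.1 → v ∈ G.1 → w ∈ G.1 := by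
  obtain ⟨e, f, hrow, hcol⟩ := exists_doubly_lexical_order (fun (F : E) (v : α) => v ∈ F.1)
  refine ⟨fun F => (e F).val, f, Fin.val_injective.comp e.injective, ?_⟩
  intro F G v w hFG hvw hvF hwF hvG
  by_contra hwG
  have step : ∀ {k : ℕ} (_ : 2 ≤ k) {r : ℕ → E} {c : ℕ → α}
      (_ : BentPath (fun (F : E) (v : α) => v ∈ F.1) (fun F => (e F).val) (fun v => (f v).val)
        k r c), _ := fun hk _ _ h => h.exists_prolongation
      (fun x x' y hlt h1 h2 => exists_last_difference (fun v => (f v).val)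
        (Fin.val_injective.comp f.injective) _ _ (hrow x x' hlt) h1 h2)
      (fun y y' x hlt h1 h2 => exists_last_difference (fun F => (e F).val)
        (Fin.val_injective.comp e.injective) (fun F : E => y ∈ F.1) (fun F : E => y' ∈ F.1)
        (hcol y y' hlt) h1 h2) hk
  have hpath : ∀ m : ℕ, ∃ (r : ℕ → E) (c : ℕ → α),
      BentPath (fun (F : E) (v : α) => v ∈ F.1) (fun F => (e F).val) (fun v => (f v).val)
        (m + 2) r c := by
    intro m
    induction m with
    | zero =>
      refine ⟨fun i => if i = 0 then F else G, fun i => if i = 0 then v else w, ?_, ?_, ?_, ?_, ?_⟩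
      · intro i j hi hj
        interval_cases i <;> interval_cases j <;> simp [*]
      · intro i j hij hj
        obtain rfl : i = 0 := by omega
        obtain rfl : j = 1 := by omega
        simpa using hFG
      · intro i j hij hj
        obtain rfl : i = 0 := by omega
        obtain rfl : j = 1 := by omega
        simpa using hvw
      · intro x _ i j hi hj
        obtain rfl : i = 0 := by omega
        obtain rfl : j = 0 := by omega
        rfl
      · intro x _ i j hi hj
        obtain rfl : i = 0 := by omega
        obtain rfl : j = 0 := by omega
        rfl
    | succ m ih =>
      obtain ⟨r, c, h⟩ := ih
      obtain ⟨x, y, hclosed, hopen⟩ := step (by omega) h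
      refine hopen fun hxy => hacyc ?_
      obtain ⟨r', c', hr', hc', hrel⟩ := hclosed hxy
      refine hasBetaCycle_of_closed_path (k := m + 2) (by omega) (fun i => (r' i).1) c'
        (fun i => (r' i).2) ?_ ?_ hrel
      · intro i j hi hj hij
        have hij := Subtype.ext hij
        rcases lt_trichotomy i j with hlt | heq | hlt
        · exact absurd (hr' i j hlt hj) (by simp [hij])
        · exact heq
        · exact absurd (hr' j i hlt hi) (by simp [hij])
      · intro i j hi hj hij
        rcases lt_trichotomy i j with hlt | heq | hlt
        · exact absurd (hc' i j hlt hj) (by simp [hij])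
        · exact heq
        · exact absurd (hc' j i hlt hi) (by simp [hij])
  obtain ⟨r, c, h⟩ := hpath (Fintype.card α)
  have hinj : Function.Injective fun i : Fin (Fintype.card α + 2) => c i.val := by
    intro i j hij
    simp only at hij
    rcases lt_trichotomy i j with hlt | heq | hlt
    · exact absurd (h.col_lt i j hlt j.2) (by simp [hij])
    · exact heq
    · exact absurd (h.col_lt j i hlt i.2) (by simp [hij])
  have := Fintype.card_le_of_injective _ hinj
  rw [Fintype.card_fin] at this
  omega

/-- If the hypergraph of the query (vertices = attributes, hyperedges = attribute sets of the
relations) is β-acyclic, then there is a GAO `ρ = (A_1, …, A_n)` such that for every `k`,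
every tuple `(t_1, …, t_{k-1})` and any two patterns of length `k - 1` generalizing that
tuple — patterns being vectors over `ℕ ∪ {*}` (here `Option ℕ`, `none` being `*`) — whose
supports are each either all of `{1, …, k-1}` or the set of positions of the attributes of
some hyperedge containing `A_k`, one of the two patterns specializes the other. -/
theorem stmt_10 [Fintype α] (E : Finset (Finset α)) (hacyc : BetaAcyclic E) :
    ∃ ρ : List α, ρ.Nodup ∧ (∀ a : α, a ∈ ρ) ∧
      ∀ (k : Fin ρ.length) (t : ℕ → ℕ) (p q : ℕ → Option ℕ),
        -- `p` generalizes `(t_1, …, t_{k-1})`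
        (∀ j, j < k.val → ∀ x : ℕ, p j = some x → x = t j) →
        -- the support of `p` is full or matches a hyperedge containing `A_k`
        ((∀ j, j < k.val → (p j).isSome) ∨
          ∃ F ∈ E, ρ.get k ∈ F ∧
            ∀ j (hj : j < k.val), ((p j).isSome ↔ ρ.get ⟨j, hj.trans k.isLt⟩ ∈ F)) →
        -- likewise for `q`
        (∀ j, j < k.val → ∀ x : ℕ, q j = some x → x = t j) →
        ((∀ j, j < k.val → (q j).isSome) ∨
          ∃ F ∈ E, ρ.get k ∈ F ∧
            ∀ j (hj : j < k.val), ((q j).isSome ↔ ρ.get ⟨j, hj.trans k.isLt⟩ ∈ F)) →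
        -- conclusion: the two patterns are comparable in the specialization order
        ((∀ j, j < k.val → ∀ x : ℕ, q j = some x → p j = some x) ∨
          (∀ j, j < k.val → ∀ x : ℕ, p j = some x → q j = some x)) := by
  obtain ⟨e, f, he, hΓ⟩ := hacyc.exists_gamma_free_order
  refine ⟨List.ofFn fun i => f.symm i.rev, ?_, fun a => ?_, ?_⟩
  · exact List.nodup_ofFn.2 (f.symm.injective.comp Fin.rev_injective)
  · exact List.mem_ofFn.2 ⟨(f a).rev, by simp⟩
  intro k t p q hpt hp hqt hq
  have hkn : k.val < Fintype.card α := by simpa using k.isLt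
  -- on generalizations of `t`, inclusion of supports gives specialization
  have hspec : ∀ p q : ℕ → Option ℕ, (∀ j, j < k.val → ∀ x : ℕ, p j = some x → x = t j) →
      (∀ j, j < k.val → ∀ x : ℕ, q j = some x → x = t j) →
      (∀ j, j < k.val → (p j).isSome → (q j).isSome) →
      ∀ j, j < k.val → ∀ x : ℕ, p j = some x → q j = some x := by
    intro p q hpt hqt hpq j hj x hx
    obtain ⟨y, hy⟩ := Option.isSome_iff_exists.1 (hpq j hj (by simp [hx]))
    rw [hy, hqt j hj y hy, hpt j hj x hx]
  have hchain : ∀ F G : E, e F < e G → f.symm (Fin.rev ⟨k, hkn⟩) ∈ F.1 →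
      f.symm (Fin.rev ⟨k, hkn⟩) ∈ G.1 → ∀ j (hj : j < k.val),
      f.symm (Fin.rev ⟨j, hj.trans hkn⟩) ∈ F.1 → f.symm (Fin.rev ⟨j, hj.trans hkn⟩) ∈ G.1 := by
    intro F G hFG hkF hkG j hj hjF
    refine hΓ F G _ _ hFG ?_ hkF hjF hkG
    simpa using hj
  rcases hp with hp | ⟨F, hFE, hkF, hp⟩
  · exact Or.inl (hspec q p hqt hpt fun j hj _ => hp j hj)
  rcases hq with hq | ⟨G, hGE, hkG, hq⟩
  · exact Or.inr (hspec p q hpt hqt fun j hj _ => hq j hj)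
  simp only [List.get_eq_getElem, List.getElem_ofFn] at hkF hkG hp hq
  rcases lt_trichotomy (e ⟨F, hFE⟩) (e ⟨G, hGE⟩) with hlt | heq | hlt
  · refine Or.inr (hspec p q hpt hqt fun j hj h => (hq j hj).2 ?_)
    exact hchain _ _ hlt hkF hkG j hj ((hp j hj).1 h)
  · obtain rfl : F = G := congrArg Subtype.val (he heq)
    exact Or.inr (hspec p q hpt hqt fun j hj h => (hq j hj).2 ((hp j hj).1 h))
  · refine Or.inl (hspec q p hqt hpt fun j hj h => (hp j hj).2 ?_)
    exact hchain _ _ hlt hkG hkF j hj ((hq j hj).1 h)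
end

section
/- Let Q be a natural join query with attributes A_1, …, A_n and relations R_1, …, R_m whose hypergraph contains a β-cycle of length c ≥ 3 through R_1, …, R_c and A_1, …, A_c; concretely, the attribute set of R_i intersected with {A_1, …, A_c} equals {A_{i−1}, A_i} for every 1 < i ≤ c, and equals {A_1, A_c} for i = 1. Let V_1, …, V_c be pairwise disjoint finite subsets of ℕ \ {1}, and let E be the disjoint union of edge sets E_{i,i+1} ⊆ V_i × V_{i+1} for 1 ≤ i < c together with E_{1,c} ⊆ V_1 × V_c. Define the instance: R_1 consists of the tuples with A_1-value u, A_c-value v, and value 1 on every other attribute of R_1, for each (u, v) ∈ E_{1,c}; for 1 < i ≤ c, R_i consists of the tuples with A_{i−1}-value u, A_i-value v, and value 1 on every other attribute of R_i, for each (u, v) ∈ E_{i−1,i}; and for c < i ≤ m, R_i consists of all tuples whose A_j-value ranges over V_j for every attribute A_j of R_i with j ∈ [c] and which equal 1 on every other attribute of R_i. Then the output tuples of Q on this instance are in one-to-one correspondence with the tuples (u_1, …, u_c) ∈ V_1 × ⋯ × V_c satisfying (u_i, u_{i+1}) ∈ E_{i,i+1} for all 1 ≤ i < c and (u_1, u_c)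 ∈ E_{1,c} (the c-cycles with one vertex per part); the correspondence assigns A_j ↦ u_j for j ∈ [c] and value 1 to every other attribute. -/
/-- Embedding a hard cycle instance into a query whose hypergraph has a β-cycle of length
`c` through the relations `R_1, …, R_c` and the attributes `A_1, …, A_c`:
the output tuples are in one-to-one correspondence with the `c`-cycles
`(u_1, …, u_c) ∈ V_1 × ⋯ × V_c` of the underlying `c`-partite graph; the correspondence
assigns `A_j ↦ u_j` for `j ∈ [c]` and the value `1` to every other attribute.

Attributes are `Fin n` (`0`-based, so `A_j` is `⟨j - 1, _⟩`), relations are indexed by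
`Fin m`, and a tuple of the instance is a function `Fin n → ℕ`, set to `0` outside the
attributes of its relation. -/
theorem stmt_17 (n m c : ℕ) (hc : 3 ≤ c) (hcm : c ≤ m) (hcn : c ≤ n)
    (attrs : Fin m → Finset (Fin n))
    (hcover : ∀ a : Fin n, ∃ i : Fin m, a ∈ attrs i)
    -- the attribute set of `R_1` meets the cycle attributes in `{A_1, A_c}`
    (hattr0 : attrs ⟨0, by omega⟩ ∩ Finset.univ.filter (fun a : Fin n => (a : ℕ) < c) =
      {⟨0, by omega⟩, ⟨c - 1, by omega⟩})
    -- the attribute set of `R_i` (`1 < i ≤ c`) meets the cycle attributes in `{A_{i-1}, A_i}`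
    (hattrs : ∀ i : Fin m, ∀ (hi0 : 0 < (i : ℕ)) (hic : (i : ℕ) < c),
      attrs i ∩ Finset.univ.filter (fun a : Fin n => (a : ℕ) < c) =
        {⟨(i : ℕ) - 1, by omega⟩, ⟨(i : ℕ), by omega⟩})
    -- the parts `V_1, …, V_c`: pairwise disjoint finite subsets of `ℕ ∖ {1}`
    (V : ℕ → Set ℕ)
    (hVfin : ∀ j, j < c → (V j).Finite) (hV1 : ∀ j, j < c → 1 ∉ V j)
    (hVdisj : ∀ j j', j < c → j' < c → j ≠ j' → Disjoint (V j) (V j'))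
    -- the edge sets `E_{i,i+1} ⊆ V_i × V_{i+1}` and `E_{1,c} ⊆ V_1 × V_c`
    (Eseq : ℕ → Set (ℕ × ℕ))
    (hEseq : ∀ j, j + 1 < c → Eseq j ⊆ {p : ℕ × ℕ | p.1 ∈ V j ∧ p.2 ∈ V (j + 1)})
    (Elast : Set (ℕ × ℕ)) (hElast : Elast ⊆ {p : ℕ × ℕ | p.1 ∈ V 0 ∧ p.2 ∈ V (c - 1)})
    -- the database instance
    (D : Fin m → Set (Fin n → ℕ))
    (hD0 : D ⟨0, by omega⟩ = {t | ∃ p ∈ Elast,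
      t ⟨0, by omega⟩ = p.1 ∧ t ⟨c - 1, by omega⟩ = p.2 ∧
      (∀ a ∈ attrs ⟨0, by omega⟩, c ≤ (a : ℕ) → t a = 1) ∧
      (∀ a : Fin n, a ∉ attrs ⟨0, by omega⟩ → t a = 0)})
    (hDcyc : ∀ i : Fin m, ∀ (hi0 : 0 < (i : ℕ)) (hic : (i : ℕ) < c),
      D i = {t | ∃ p ∈ Eseq ((i : ℕ) - 1),
        t ⟨(i : ℕ) - 1, by omega⟩ = p.1 ∧ t ⟨(i : ℕ), by omega⟩ = p.2 ∧
        (∀ a ∈ attrs i, c ≤ (a : ℕ) → t a = 1) ∧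
        (∀ a : Fin n, a ∉ attrs i → t a = 0)})
    (hDtop : ∀ i : Fin m, c ≤ (i : ℕ) →
      D i = {t | (∀ j : ℕ, ∀ (hj : j < c),
          (⟨j, by omega⟩ : Fin n) ∈ attrs i → t ⟨j, by omega⟩ ∈ V j) ∧
        (∀ a ∈ attrs i, c ≤ (a : ℕ) → t a = 1) ∧
        (∀ a : Fin n, a ∉ attrs i → t a = 0)}) :
    -- one-to-one correspondence between output tuples and `c`-cycles
    (∀ t : Fin n → ℕ,
      (∀ i : Fin m, ∃ u ∈ D i, ∀ a ∈ attrs i, u a = t a) ↔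
      ∃ u : Fin c → ℕ,
        ((∀ j : ℕ, ∀ (hj : j + 1 < c),
            (u ⟨j, by omega⟩, u ⟨j + 1, by omega⟩) ∈ Eseq j) ∧
          (u ⟨0, by omega⟩, u ⟨c - 1, by omega⟩) ∈ Elast) ∧
        t = fun a : Fin n => if h : (a : ℕ) < c then u ⟨(a : ℕ), h⟩ else 1) ∧
    Function.Injective (fun (u : Fin c → ℕ) =>
      (fun a : Fin n => if h : (a : ℕ) < c then u ⟨(a : ℕ), h⟩ else 1)) := by
  have hm : 0 < m := by omega
  have mem0 : (⟨0, by omega⟩ : Fin n) ∈ attrs ⟨0, by omega⟩ ∧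
      (⟨c - 1, by omega⟩ : Fin n) ∈ attrs ⟨0, by omega⟩ := by
    constructor <;> refine Finset.inter_subset_left (hattr0.ge ?_) <;> simp
  have memcyc : ∀ i : Fin m, ∀ (hi0 : 0 < (i : ℕ)) (hic : (i : ℕ) < c),
      (⟨(i : ℕ) - 1, by omega⟩ : Fin n) ∈ attrs i ∧ (⟨(i : ℕ), by omega⟩ : Fin n) ∈ attrs i := by
    intro i hi0 hic
    constructor <;> refine Finset.inter_subset_left ((hattrs i hi0 hic).ge ?_) <;> simp
  refine ⟨fun t => ⟨fun ht => ?_, ?_⟩, ?_⟩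
  · refine ⟨fun j => t ⟨j, by omega⟩, ⟨fun j hj => ?_, ?_⟩, ?_⟩
    · obtain ⟨w, hw, hwt⟩ := ht ⟨j + 1, by omega⟩
      rw [hDcyc ⟨j + 1, by omega⟩ (Nat.succ_pos j) hj] at hw
      obtain ⟨p, hp, h1, h2, -, -⟩ := hw
      obtain ⟨m1, m2⟩ := memcyc ⟨j + 1, by omega⟩ (Nat.succ_pos j) hj
      rw [hwt _ m1] at h1
      rw [hwt _ m2] at h2
      simp only [Nat.add_sub_cancel] at h1 h2 hp
      simpa only [h1, h2] using hp
    · obtain ⟨w, hw, hwt⟩ := ht ⟨0, by omega⟩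
      rw [hD0] at hw
      obtain ⟨p, hp, h1, h2, -, -⟩ := hw
      rw [hwt _ mem0.1] at h1
      rw [hwt _ mem0.2] at h2
      simpa only [h1, h2] using hp
    · funext a
      split_ifs with h
      · rfl
      · obtain ⟨i, hai⟩ := hcover a
        obtain ⟨w, hw, hwt⟩ := ht i
        rw [← hwt a hai]
        have hca : c ≤ (a : ℕ) := not_lt.1 h
        by_cases hic : (i : ℕ) < c
        · rcases Nat.eq_zero_or_pos (i : ℕ) with hi0 | hi0
          · obtain rfl : i = ⟨0, hm⟩ := Fin.ext hi0
            rw [hD0] at hw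
            obtain ⟨p, -, -, -, h1, -⟩ := hw
            exact h1 a hai hca
          · rw [hDcyc i hi0 hic] at hw
            obtain ⟨p, -, -, -, h1, -⟩ := hw
            exact h1 a hai hca
        · rw [hDtop i (not_lt.1 hic)] at hw
          exact hw.2.1 a hai hca
  · rintro ⟨u, ⟨hseq, hlast⟩, rfl⟩ i
    have huV : ∀ j, ∀ hj : j < c, u ⟨j, hj⟩ ∈ V j := by
      intro j hj
      by_cases hj' : j + 1 < c
      · exact (hEseq j hj' (hseq j hj')).1
      · obtain rfl : j = c - 1 := by omega
        exact (hElast hlast).2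
    refine ⟨fun a => if a ∈ attrs i then (if h : (a : ℕ) < c then u ⟨(a : ℕ), h⟩ else 1) else 0,
      ?_, fun a ha => if_pos ha⟩
    have hone : ∀ a ∈ attrs i, c ≤ (a : ℕ) →
        (if a ∈ attrs i then (if h : (a : ℕ) < c then u ⟨(a : ℕ), h⟩ else 1) else 0) = 1 :=
      fun a ha hca => by rw [if_pos ha, dif_neg (not_lt.2 hca)]
    have hzero : ∀ a, a ∉ attrs i →
        (if a ∈ attrs i then (if h : (a : ℕ) < c then u ⟨(a : ℕ), h⟩ else 1) else 0) = 0 :=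
      fun a ha => if_neg ha
    by_cases hic : (i : ℕ) < c
    · rcases Nat.eq_zero_or_pos (i : ℕ) with hi0 | hi0
      · obtain rfl : i = ⟨0, hm⟩ := Fin.ext hi0
        rw [hD0]
        refine ⟨_, hlast, ?_, ?_, hone, hzero⟩
        · simp only [if_pos mem0.1]
          exact dif_pos (by omega)
        · simp only [if_pos mem0.2]
          exact dif_pos (by omega)
      · obtain ⟨m1, m2⟩ := memcyc i hi0 hic
        rw [hDcyc i hi0 hic]
        refine ⟨_, hseq (i - 1) (by omega), ?_, ?_, hone, hzero⟩
        · simp only [if_pos m1]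
          exact dif_pos (by omega)
        · simp only [if_pos m2, Nat.sub_add_cancel hi0]
          exact dif_pos (by omega)
    · rw [hDtop i (not_lt.1 hic)]
      refine ⟨fun j hj hji => ?_, hone, hzero⟩
      simp only [if_pos hji, dif_pos hj]
      exact huV j hj
  · intro u v huv
    funext j
    simpa using congrFun huv ⟨j, by omega⟩
end
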